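/- arXiv:0805.3513 — 2 statements merged into one kernel-verified Lean document; each statement's English description precedes it below -/
import Mathlib

section
/- Let H be a complex Hilbert space and S a ℂ-linear subspace of B(H). Then every element of S is a scalar multiple of an isometry if and only if for every A, B ∈ S there exists λ ∈ ℂ such that B*A = λ·I. -/
/-- `A` is a scalar multiple of an isometry. -/
def ScalarMultipleOfIsometry {H : Type*} [NormedAddCommGroup H] [InnerProductSpace ℂ H]
    (A : H →L[ℂ] H) : Prop :=
  ∃ (c : ℂ) (V : H →L[ℂ] H), Isometry V ∧ A = c • V

theorem aux_star_self {H : Type*} [NormedAddCommGroup H] [InnerProductSpace ℂ H] [CompleteSpace H]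
    (A : H →L[ℂ] H) (h : ScalarMultipleOfIsometry A) :
    ∃ lam : ℂ, ContinuousLinearMap.adjoint A * A = lam • (1 : H →L[ℂ] H) := by
  obtain ⟨c, V, hV, rfl⟩ := h
  have h1 : ContinuousLinearMap.adjoint V * V = 1 := by
    have := (ContinuousLinearMap.norm_map_iff_adjoint_comp_self V).1
      (fun x => (AddMonoidHomClass.isometry_iff_norm V).1 hV x)
    exact this
  refine ⟨c * starRingEnd ℂ c, ?_⟩
  rw [map_smulₛₗ, smul_mul_smul_comm, h1, mul_comm]

theorem stmt_1 {H : Type*} [NormedAddCommGroup H] [InnerProductSpace ℂ H] [CompleteSpace H]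
    (S : Submodule ℂ (H →L[ℂ] H)) :
    (∀ A ∈ S, ScalarMultipleOfIsometry A) ↔
      ∀ A ∈ S, ∀ B ∈ S, ∃ lam : ℂ,
        ContinuousLinearMap.adjoint B * A = lam • (1 : H →L[ℂ] H) := by
  constructor
  · intro h A hA B hB
    obtain ⟨a, ha⟩ := aux_star_self A (h A hA)
    obtain ⟨b, hb⟩ := aux_star_self B (h B hB)
    obtain ⟨p, hp⟩ := aux_star_self _ (h _ (S.add_mem hA hB))
    obtain ⟨q, hq⟩ := aux_star_self _ (h _ (S.add_mem hA (S.smul_mem Complex.I hB)))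
    refine ⟨((p - a - b) + Complex.I * (q - a - b)) / 2, ?_⟩
    rw [map_add] at hp hq
    rw [map_smulₛₗ] at hq
    simp only [add_mul, mul_add, smul_mul_assoc, mul_smul_comm, smul_smul, ha, hb,
      Complex.conj_I, neg_mul, mul_neg, Complex.I_mul_I, neg_neg, one_smul] at hp hq
    have hI : Complex.I * Complex.I = -1 := Complex.I_mul_I
    have h2 := congrArg (fun T => (1/2 : ℂ) • T) hp
    have h3 := congrArg (fun T => (Complex.I/2 : ℂ) • T) hq
    ext x
    have h4 := congrArg (fun T : H →L[ℂ] H => T x) h2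
    have h5 := congrArg (fun T : H →L[ℂ] H => T x) h3
    simp only [ContinuousLinearMap.smul_apply, ContinuousLinearMap.add_apply,
      ContinuousLinearMap.one_apply] at h4 h5 ⊢
    linear_combination (norm := skip) h4 + h5
    match_scalars <;> ring_nf <;> simp <;> ring_nf
  · intro h A hA
    obtain ⟨l, hl⟩ := h A hA A hA
    have hn : ∀ x, ‖A x‖ ^ 2 = l.re * ‖x‖ ^ 2 := by
      intro x
      have h1 : inner ℂ x ((ContinuousLinearMap.adjoint A * A) x) = inner ℂ (A x) (A x) := by
        rw [ContinuousLinearMap.mul_apply, ContinuousLinearMap.adjoint_inner_right]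
      rw [hl, ContinuousLinearMap.smul_apply, ContinuousLinearMap.one_apply, inner_smul_right,
        inner_self_eq_norm_sq_to_K, inner_self_eq_norm_sq_to_K] at h1
      have h3 : l * ((‖x‖ ^ 2 : ℝ) : ℂ) = ((‖A x‖ ^ 2 : ℝ) : ℂ) := by
        push_cast
        exact h1
      have h2 := congrArg Complex.re h3
      rw [Complex.re_mul_ofReal, Complex.ofReal_re] at h2
      exact h2.symm
    by_cases h0 : A = 0
    · exact ⟨0, 1, isometry_id, by simp [h0]⟩
    · obtain ⟨x, hx⟩ : ∃ x, A x ≠ 0 := by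
        by_contra hc
        push Not at hc
        exact h0 (ContinuousLinearMap.ext hc)
      have hr : 0 < l.re := by
        have h1 : 0 < ‖A x‖ ^ 2 := by positivity
        rw [hn x] at h1
        exact pos_of_mul_pos_left h1 (by positivity)
      have hs : 0 < Real.sqrt l.re := Real.sqrt_pos.2 hr
      have hc : ((Real.sqrt l.re : ℝ) : ℂ) ≠ 0 := by exact_mod_cast hs.ne'
      refine ⟨(Real.sqrt l.re : ℝ), ((Real.sqrt l.re : ℝ) : ℂ)⁻¹ • A, ?_, ?_⟩
      · refine (AddMonoidHomClass.isometry_iff_norm _).2 fun y => ?_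
        have h1 : ‖A y‖ = Real.sqrt l.re * ‖y‖ := by
          rw [← Real.sqrt_sq (norm_nonneg (A y)), hn, Real.sqrt_mul hr.le,
            Real.sqrt_sq (norm_nonneg y)]
        rw [ContinuousLinearMap.smul_apply, norm_smul, h1, norm_inv, Complex.norm_real,
          Real.norm_of_nonneg hs.le, inv_mul_cancel_left₀ hs.ne']
      · rw [smul_smul, mul_inv_cancel₀ hc, one_smul]
end

section
/- Let H be a complex Hilbert space and S an MI-space in B(H). If S contains a unitary operator A, then S = span(A). -/
open ContinuousLinearMap in
theorem aux_scalar {H : Type*} [NormedAddCommGroup H] [InnerProductSpace ℂ H] [CompleteSpace H]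
    (T : H →L[ℂ] H) (h : ScalarMultipleOfIsometry T) :
    ∃ r : ℂ, star T * T = r • (1 : H →L[ℂ] H) := by
  obtain ⟨c, V, hV, rfl⟩ := h
  have h1 : star V * V = 1 := by
    have := (ContinuousLinearMap.norm_map_iff_adjoint_comp_self V).1
      ((AddMonoidHomClass.isometry_iff_norm V).1 hV)
    exact this
  refine ⟨star c * c, ?_⟩
  rw [star_smul, smul_mul_smul_comm, h1]

theorem stmt_5 {H : Type*} [NormedAddCommGroup H] [InnerProductSpace ℂ H] [CompleteSpace H]
    (S : Submodule ℂ (H →L[ℂ] H))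
    (hS : ∀ T ∈ S, ScalarMultipleOfIsometry T)
    (A : H →L[ℂ] H) (hA : A ∈ S)
    (hU : ContinuousLinearMap.adjoint A * A = 1 ∧ A * ContinuousLinearMap.adjoint A = 1) :
    S = Submodule.span ℂ {A} := by
  apply le_antisymm
  · intro T hT
    obtain ⟨h1, h2⟩ := hU
    change star A * A = 1 at h1
    change A * star A = 1 at h2
    obtain ⟨a, ha⟩ := aux_scalar T (hS T hT)
    obtain ⟨b, hb⟩ := aux_scalar (T + A) (hS _ (S.add_mem hT hA))
    obtain ⟨d, hd⟩ := aux_scalar (T + Complex.I • A)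
      (hS _ (S.add_mem hT (S.smul_mem _ hA)))
    simp only [star_add, star_smul, add_mul, mul_add, smul_mul_assoc, mul_smul_comm,
      smul_add, smul_smul, h1, ha, RCLike.star_def, Complex.conj_I] at hb hd
    have e1 : star T * A + star A * T = (b - a - 1) • (1 : H →L[ℂ] H) := by
      linear_combination (norm := module) hb
    have e2 : Complex.I • (star T * A) - Complex.I • (star A * T)
        = (d - a - 1) • (1 : H →L[ℂ] H) := by
      have : -Complex.I * Complex.I = 1 := by simp
      have h3 : Complex.I * -Complex.I = 1 := by simp
      simp only [this, h3, one_smul] at hd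
      linear_combination (norm := module) hd
    have e3 : star A * T = ((b - a - 1) / 2 + Complex.I * (d - a - 1) / 2) • (1 : H →L[ℂ] H) := by
      have e4 := congrArg (fun X => Complex.I • X) e2
      simp only [smul_sub, smul_smul, Complex.I_mul_I] at e4
      have : (2 : ℂ) • (star A * T) = (b - a - 1) • (1 : H →L[ℂ] H)
          + (Complex.I * (d - a - 1)) • (1 : H →L[ℂ] H) := by
        rw [← e1, ← e4]; module
      rw [show star A * T = (1 / 2 : ℂ) • ((2 : ℂ) • (star A * T)) by module, this]
      module
    rw [Submodule.mem_span_singleton]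
    refine ⟨(b - a - 1) / 2 + Complex.I * (d - a - 1) / 2, ?_⟩
    · calc _ = A * (star A * T) := by rw [e3, mul_smul_comm, mul_one]
        _ = T := by rw [← mul_assoc, h2, one_mul]
  · rw [Submodule.span_singleton_le_iff_mem]
    exact hA
end
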